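/- Let n > 3 be an odd integer. The number of integers m with 0 ≤ m < n such that gcd(m, n) = 1, gcd(m − 1, n) = 1, and m·y − (m−1)·(m·y − (m−1)·x) ≢ x (mod n) for all distinct residues x, y modulo n — that is, the number of strictly non-right-alternative loops in L_n — equals the product, over the distinct prime divisors p of n, of (p − 3)·p^(ν_p(n) − 1), where ν_p(n) is the exponent of p in n. -/

import Mathlib

/-- The residues `a` modulo `n` such that `a`, `a - 1` and `a - 2` are all invertible. -/
def tripleUnits (n : ℕ) : Set (ZMod n) := {a | IsUnit a ∧ IsUnit (a - 1) ∧ IsUnit (a - 2)}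

lemma card_range_filter_natCast {n : ℕ} [NeZero n] {S : Set (ZMod n)} {P : ℕ → Prop}
    {_ : DecidablePred P} (hP : ∀ m, P m ↔ (m : ZMod n) ∈ S) :
    ((Finset.range n).filter P).card = Nat.card S := by
  classical
  rw [Nat.card_coe_set_eq, Set.ncard_eq_toFinset_card']
  refine Finset.card_bij (fun m _ => (m : ZMod n)) ?_ ?_ ?_
  · intro m hm
    simpa using (hP m).1 (Finset.mem_filter.1 hm).2
  · intro a ha b hb h
    simp only [Finset.mem_filter, Finset.mem_range] at ha hb
    rw [ZMod.natCast_eq_natCast_iff'] at h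
    rwa [Nat.mod_eq_of_lt ha.1, Nat.mod_eq_of_lt hb.1] at h
  · intro b hb
    refine ⟨b.val, ?_, ZMod.natCast_zmod_val b⟩
    simpa [ZMod.val_lt, hP] using hb

lemma card_tripleUnits_mul {m n : ℕ} (h : m.Coprime n) :
    Nat.card (tripleUnits (m * n)) = Nat.card (tripleUnits m) * Nat.card (tripleUnits n) := by
  let e := ZMod.chineseRemainder h
  rw [← Nat.card_prod]
  refine Nat.card_congr ((e.toEquiv.subtypeEquiv (q := fun x => x ∈ tripleUnits m ×ˢ tripleUnits n)
    fun a => ?_).trans (Equiv.Set.prod _ _))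
  have key (b : ZMod (m * n)) : IsUnit b ↔ IsUnit (e b).1 ∧ IsUnit (e b).2 := by
    rw [← Prod.isUnit_iff, MulEquiv.isUnit_map]
  simp only [tripleUnits, Set.mem_ofPred_eq, Set.mem_prod, key, map_sub, map_one, map_ofNat,
    RingEquiv.toEquiv_eq_coe, EquivLike.coe_coe, Prod.fst_sub, Prod.snd_sub, Prod.fst_one,
    Prod.snd_one, Prod.fst_ofNat, Prod.snd_ofNat]
  tauto

lemma card_tripleUnits_one : Nat.card (tripleUnits 1) = 1 := by
  have : tripleUnits 1 = Set.univ := by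
    ext a
    exact iff_of_true ⟨isUnit_of_subsingleton _, isUnit_of_subsingleton _,
      isUnit_of_subsingleton _⟩ trivial
  rw [this, Nat.card_univ, Nat.card_zmod]

lemma isUnit_intCast_zmod_prime_pow {p k : ℕ} (hp : p.Prime) (hk : k ≠ 0) (a : ℤ) :
    IsUnit (a : ZMod (p ^ k)) ↔ ¬ (p : ℤ) ∣ a := by
  rw [ZMod.coe_int_isUnit_iff_isCoprime, Nat.cast_pow, IsCoprime.pow_left_iff (by omega),
    (Nat.prime_iff_prime_int.1 hp).coprime_iff_not_dvd]

lemma natCast_mem_tripleUnits_prime_pow {p k : ℕ} (hp : p.Prime) (hp3 : 3 ≤ p) (hk : k ≠ 0)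
    (m : ℕ) : (m : ZMod (p ^ k)) ∈ tripleUnits (p ^ k) ↔ 3 ≤ m % p := by
  have key (j : ℕ) (hj : j < 3) : IsUnit ((m : ZMod (p ^ k)) - j) ↔ m % p ≠ j := by
    have := isUnit_intCast_zmod_prime_pow hp hk ((m : ℤ) - j)
    push_cast at this
    rw [this, ← Int.modEq_iff_dvd, Int.natCast_modEq_iff, Nat.ModEq,
      Nat.mod_eq_of_lt (by omega), not_iff_not, eq_comm]
  have h0 := key 0 (by omega)
  have h1 := key 1 (by omega)
  have h2 := key 2 (by omega)
  simp only [Nat.cast_zero, sub_zero, Nat.cast_one, Nat.cast_ofNat] at h0 h1 h2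
  rw [tripleUnits, Set.mem_ofPred_eq, h0, h1, h2]
  omega

lemma card_range_mul_filter_le_mod (j p a : ℕ) :
    ((Finset.range (a * p)).filter (fun m => j ≤ m % p)).card = a * (p - j) := by
  rw [← Nat.count_eq_card_filter_range]
  induction a with
  | zero => simp
  | succ a ih =>
    rw [add_mul, one_mul, Nat.count_add, ih, add_mul, one_mul, Nat.count_eq_card_filter_range]
    congr 1
    rw [← Nat.card_Ico]
    congr 1
    ext m
    simp only [Finset.mem_filter, Finset.mem_range, Finset.mem_Ico, Nat.mul_add_mod_self_right]
    constructor
    · rintro ⟨h, h'⟩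
      rw [Nat.mod_eq_of_lt h] at h'
      exact ⟨h', h⟩
    · rintro ⟨h, h'⟩
      rw [Nat.mod_eq_of_lt h']
      exact ⟨h', h⟩

lemma card_tripleUnits_prime_pow {p k : ℕ} (hp : p.Prime) (hp3 : 3 ≤ p) (hk : k ≠ 0) :
    Nat.card (tripleUnits (p ^ k)) = (p - 3) * p ^ (k - 1) := by
  have : NeZero (p ^ k) := ⟨pow_ne_zero _ hp.ne_zero⟩
  rw [mul_comm, ← card_range_mul_filter_le_mod, pow_sub_one_mul hk]
  exact (card_range_filter_natCast fun m =>
    (natCast_mem_tripleUnits_prime_pow hp hp3 hk m).symm).symm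

lemma card_tripleUnits {n : ℕ} (hodd : Odd n) :
    Nat.card (tripleUnits n) = ∏ p ∈ n.primeFactors, (p - 3) * p ^ (n.factorization p - 1) := by
  rw [Nat.multiplicative_factorization (fun n => Nat.card (tripleUnits n))
    (fun _ _ => card_tripleUnits_mul) card_tripleUnits_one hodd.pos.ne']
  refine Finset.prod_congr rfl fun p hp => ?_
  have hpp := Nat.prime_of_mem_primeFactors hp
  have hpo := hodd.of_dvd_nat (Nat.dvd_of_mem_primeFactors hp)
  refine card_tripleUnits_prime_pow hpp ?_ (Finsupp.mem_support_iff.1 hp)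
  have := hpp.two_le
  obtain ⟨c, rfl⟩ := hpo
  omega

/-- Right alternativity fails on all pairs of distinct elements exactly when `a * (a - 2)` is
regular. -/
lemma strictlyNonRightAlternative_iff {R : Type*} [CommRing R] [Finite R] (a : R) :
    (∀ x y : R, x ≠ y → a * y - (a - 1) * (a * y - (a - 1) * x) ≠ x) ↔
      IsUnit (a * (a - 2)) := by
  have key (x y : R) : a * y - (a - 1) * (a * y - (a - 1) * x) - x = a * (a - 2) * (x - y) := by
    ring
  rw [isUnit_iff_mem_nonZeroDivisors_of_finite, mem_nonZeroDivisors_iff_left]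
  constructor
  · intro h z hz
    by_contra hne
    refine h z 0 hne (sub_eq_zero.1 ?_)
    rw [key, sub_zero, hz]
  · intro h x y hxy hx
    exact hxy (sub_eq_zero.1 (h _ (by rw [← key, sub_eq_zero, hx])))

open Classical

/-- The number of strictly non-right-alternative loops in the class `Lₙ` equals
`∏_{p ∣ n} (p-3)·p^(ν_p(n)-1)`. -/
theorem stmt_8 (n : ℕ) (hn : 3 < n) (hodd : Odd n) :
    ((Finset.range n).filter
        (fun m => Nat.gcd m n = 1 ∧ Nat.gcd (m - 1) n = 1 ∧
          ∀ x y : ZMod n, x ≠ y →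
            (m : ZMod n) * y
                - ((m : ZMod n) - 1) * ((m : ZMod n) * y - ((m : ZMod n) - 1) * x)
              ≠ x)).card
      = ∏ p ∈ n.primeFactors, (p - 3) * p ^ (n.factorization p - 1) := by
  have : NeZero n := ⟨by omega⟩
  rw [← card_tripleUnits hodd]
  refine card_range_filter_natCast fun m => ?_
  rw [strictlyNonRightAlternative_iff, IsUnit.mul_iff, tripleUnits, Set.mem_ofPred_eq,
    ZMod.isUnit_iff_coprime]
  rcases m with _ | m
  · simp only [Nat.coprime_zero_left, Nat.gcd_zero_left]
    omega
  · have h1 : ((m + 1 : ℕ) : ZMod n) - 1 = (m : ℕ) := by push_cast; ring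
    rw [h1, ZMod.isUnit_iff_coprime, Nat.add_sub_cancel]
    unfold Nat.Coprime
    tauto
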